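/- Let μ₀ be a probability measure on X and G : X → ℝ^d measurable with ∫_X |G(u)|² dμ₀(u) < ∞. Suppose there exist a measurable set X₀ ⊆ X with μ₀(X₀) > 0 and B ≥ 0 such that |G(u)| ≤ B for all u ∈ X₀ (so that Z_G(y) > 0 for all y). Then for every r > 0 there exists a constant C = C(r) > 0 such that for all y₁, y₂ ∈ ℝ^d with |y₁| ≤ r and |y₂| ≤ r, the posterior measures satisfy the stability estimate d_H(μ_G^{y₁}, μ_G^{y₂}) ≤ C|y₁ − y₂|. -/

import Mathlib

open MeasureTheory Real Filter

/-- The squared norm induced by the inverse of the diagonal covariance matrix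
`Γ = diag(σ₁², …, σ_d²)`: `|v|_Γ² = ∑ i, σ i ⁻² * (v i)²`. -/
noncomputable def gammaNormSq {d : ℕ} (σ : Fin d → ℝ) (v : EuclideanSpace ℝ (Fin d)) : ℝ :=
  ∑ i, (v i) ^ 2 / (σ i) ^ 2

/-- The Bayesian potential `Φ_G(u, y) = ½|G(u) − y|_Γ² − ½|y|_Γ²`. -/
noncomputable def potential {X : Type*} {d : ℕ} (σ : Fin d → ℝ)
    (G : X → EuclideanSpace ℝ (Fin d)) (u : X) (y : EuclideanSpace ℝ (Fin d)) : ℝ :=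
  (1 / 2) * gammaNormSq σ (G u - y) - (1 / 2) * gammaNormSq σ y

/-- The normalization constant `Z_G(y) = ∫_X exp(−Φ_G(u, y)) dμ₀(u)`. -/
noncomputable def Zconst {X : Type*} [MeasurableSpace X] {d : ℕ} (σ : Fin d → ℝ)
    (G : X → EuclideanSpace ℝ (Fin d)) (μ₀ : Measure X)
    (y : EuclideanSpace ℝ (Fin d)) : ℝ :=
  ∫ u, Real.exp (-(potential σ G u y)) ∂μ₀

lemma aux_apply_le {d : ℕ} (v : EuclideanSpace ℝ (Fin d)) (i : Fin d) : |v i| ≤ ‖v‖ := by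
  have := PiLp.norm_apply_le v i
  simpa using this

lemma aux_gns_nonneg {d : ℕ} (σ : Fin d → ℝ) (v : EuclideanSpace ℝ (Fin d)) :
    0 ≤ gammaNormSq σ v := by
  unfold gammaNormSq
  positivity

lemma aux_gns_le {d : ℕ} (σ : Fin d → ℝ) (v : EuclideanSpace ℝ (Fin d)) :
    gammaNormSq σ v ≤ (∑ i, 1 / (σ i) ^ 2) * ‖v‖ ^ 2 := by
  unfold gammaNormSq
  rw [Finset.sum_mul]
  refine Finset.sum_le_sum fun i _ => ?_
  have h : (v i) ^ 2 ≤ ‖v‖ ^ 2 := by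
    rw [← sq_abs (v i)]
    exact pow_le_pow_left₀ (abs_nonneg _) (aux_apply_le v i) 2
  rw [div_eq_mul_one_div, mul_comm]
  exact mul_le_mul_of_nonneg_left h (by positivity)

lemma aux_pair_le {d : ℕ} (σ : Fin d → ℝ) (v w : EuclideanSpace ℝ (Fin d)) :
    |∑ i, v i * w i / (σ i) ^ 2| ≤ (∑ i, 1 / (σ i) ^ 2) * (‖v‖ * ‖w‖) := by
  refine (Finset.abs_sum_le_sum_abs _ _).trans ?_
  rw [Finset.sum_mul]
  refine Finset.sum_le_sum fun i _ => ?_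
  rw [div_eq_mul_one_div, mul_comm, abs_mul, abs_mul, abs_of_nonneg (by positivity : 0 ≤ 1 / σ i ^ 2)]
  exact mul_le_mul_of_nonneg_left
    (mul_le_mul (aux_apply_le v i) (aux_apply_le w i) (abs_nonneg _) (norm_nonneg _)) (by positivity)

lemma aux_pot {X : Type*} {d : ℕ} (σ : Fin d → ℝ)
    (G : X → EuclideanSpace ℝ (Fin d)) (u : X) (y : EuclideanSpace ℝ (Fin d)) :
    potential σ G u y = (1 / 2) * gammaNormSq σ (G u) - ∑ i, G u i * y i / (σ i) ^ 2 := by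
  unfold potential gammaNormSq
  rw [Finset.mul_sum, Finset.mul_sum, Finset.mul_sum, ← Finset.sum_sub_distrib,
    ← Finset.sum_sub_distrib]
  refine Finset.sum_congr rfl fun i _ => ?_
  simp only [PiLp.sub_apply]
  ring

lemma aux_pot_sub {X : Type*} {d : ℕ} (σ : Fin d → ℝ)
    (G : X → EuclideanSpace ℝ (Fin d)) (u : X) (y z : EuclideanSpace ℝ (Fin d)) :
    |potential σ G u y - potential σ G u z| ≤ (∑ i, 1 / (σ i) ^ 2) * (‖G u‖ * ‖y - z‖) := by
  have h : potential σ G u y - potential σ G u z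
      = - ∑ i, G u i * (y - z) i / (σ i) ^ 2 := by
    rw [aux_pot, aux_pot]
    have : ∑ i, G u i * (y - z) i / (σ i) ^ 2
      = ∑ i, G u i * y i / (σ i) ^ 2 - ∑ i, G u i * z i / (σ i) ^ 2 := by
      rw [← Finset.sum_sub_distrib]
      refine Finset.sum_congr rfl fun i _ => ?_
      simp only [PiLp.sub_apply]
      ring
    rw [this]; ring
  rw [h, abs_neg]
  exact aux_pair_le σ _ _

lemma aux_exp_sub {x y K : ℝ} (hx : exp x ≤ K) (hy : exp y ≤ K) :
    |exp x - exp y| ≤ K * |x - y| := by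
  have key : ∀ a b : ℝ, exp a ≤ K → exp a - exp b ≤ K * |a - b| := by
    intro a b ha
    have h1 := add_one_le_exp (b - a)
    have h2 : exp b = exp a * exp (b - a) := by rw [← exp_add]; ring_nf
    have h3 : exp a - exp b ≤ exp a * (a - b) := by
      rw [h2]; nlinarith [exp_pos a]
    refine h3.trans ?_
    have h4 : exp a * (a - b) ≤ exp a * |a - b| :=
      mul_le_mul_of_nonneg_left (le_abs_self _) (exp_pos a).le
    exact h4.trans (mul_le_mul_of_nonneg_right ha (abs_nonneg _))
  rw [abs_sub_le_iff]
  refine ⟨key x y hx, ?_⟩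
  rw [abs_sub_comm]
  exact key y x hy

/-- Hilbert space normalization estimate. -/
lemma aux_hilbert {X : Type*} [MeasurableSpace X] (μ : Measure X) (f g : X → ℝ) (a b : ℝ)
    (ha : 0 < a) (hb : 0 < b)
    (hf : Integrable (fun u => f u ^ 2) μ) (hg : Integrable (fun u => g u ^ 2) μ)
    (hfg : Integrable (fun u => f u * g u) μ)
    (hfa : ∫ u, f u ^ 2 ∂μ = a ^ 2) (hgb : ∫ u, g u ^ 2 ∂μ = b ^ 2) :
    ∫ u, (f u / a - g u / b) ^ 2 ∂μ ≤ (∫ u, (f u - g u) ^ 2 ∂μ) / (a * b) := by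
  have gen : ∀ s t : ℝ, ∫ u, (s * f u - t * g u) ^ 2 ∂μ
      = s ^ 2 * a ^ 2 + t ^ 2 * b ^ 2 - 2 * s * t * ∫ u, f u * g u ∂μ := by
    intro s t
    have e : (fun u => (s * f u - t * g u) ^ 2)
        = fun u => (s ^ 2 * f u ^ 2 + t ^ 2 * g u ^ 2) - (2 * s * t) * (f u * g u) := by
      funext u; ring
    have hi : Integrable (fun u => s ^ 2 * f u ^ 2 + t ^ 2 * g u ^ 2) μ :=
      (hf.const_mul _).add (hg.const_mul _)
    rw [e, integral_sub hi (hfg.const_mul _),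
      integral_add (hf.const_mul _) (hg.const_mul _), integral_const_mul, integral_const_mul,
      integral_const_mul, hfa, hgb]
  have h1 := gen a⁻¹ b⁻¹
  have h2 := gen 1 1
  simp only [one_mul] at h2
  have e1 : (fun u => (f u / a - g u / b) ^ 2) = fun u => (a⁻¹ * f u - b⁻¹ * g u) ^ 2 := by
    funext u; ring
  rw [e1, h1, h2, le_div_iff₀ (mul_pos ha hb)]
  have e2 : (a⁻¹ ^ 2 * a ^ 2 + b⁻¹ ^ 2 * b ^ 2 - 2 * a⁻¹ * b⁻¹ * ∫ u, f u * g u ∂μ) * (a * b)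
      = 2 * (a * b) - 2 * ∫ u, f u * g u ∂μ := by
    field_simp; ring
  rw [e2]
  nlinarith [sq_nonneg (a - b)]

theorem stmt_14 {X : Type*} [MeasurableSpace X] {d : ℕ} (hd : 1 ≤ d)
    (σ : Fin d → ℝ) (hσ : ∀ i, 0 < σ i)
    (μ₀ : Measure X) [IsProbabilityMeasure μ₀]
    (G : X → EuclideanSpace ℝ (Fin d)) (hG : Measurable G)
    (hGsq : Integrable (fun u => ‖G u‖ ^ 2) μ₀)
    (X₀ : Set X) (hX₀ : MeasurableSet X₀) (hX₀pos : 0 < μ₀ X₀)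
    (B : ℝ) (hB : 0 ≤ B) (hGB : ∀ u ∈ X₀, ‖G u‖ ≤ B) :
    ∀ r > (0 : ℝ), ∃ C > (0 : ℝ), ∀ y₁ y₂ : EuclideanSpace ℝ (Fin d),
      ‖y₁‖ ≤ r → ‖y₂‖ ≤ r →
      Real.sqrt (1 / 2 * ∫ u,
        (Real.sqrt (Real.exp (-(potential σ G u y₁)) / Zconst σ G μ₀ y₁) -
         Real.sqrt (Real.exp (-(potential σ G u y₂)) / Zconst σ G μ₀ y₂)) ^ 2 ∂μ₀)
        ≤ C * ‖y₁ - y₂‖ := by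
  intro r hr
  set S : ℝ := ∑ i, 1 / (σ i) ^ 2 with hS
  have hS0 : 0 ≤ S := by positivity
  set K : ℝ := exp (S * r ^ 2 / 4) with hK
  set M : ℝ := ∫ u, ‖G u‖ ^ 2 ∂μ₀ with hM
  have hM0 : 0 ≤ M := integral_nonneg fun u => by positivity
  set z : ℝ := μ₀.real X₀ * exp (-(S * B ^ 2 / 2 + S * (B * r))) with hz
  have hμ : 0 < μ₀.real X₀ := by
    rw [measureReal_def]
    exact ENNReal.toReal_pos hX₀pos.ne' (measure_ne_top _ _)
  have hz0 : 0 < z := mul_pos hμ (exp_pos _)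
  have hcoord : ∀ i, Measurable fun u => G u i := fun i => by fun_prop
  have hmeas : ∀ y, Measurable fun u => potential σ G u y := by
    intro y
    simp only [aux_pot, gammaNormSq]
    fun_prop
  let F : EuclideanSpace ℝ (Fin d) → X → ℝ := fun y u => exp (-(potential σ G u y) / 2)
  have hFm : ∀ y, Measurable (F y) := fun y => by
    have := hmeas y
    simp only [F]
    fun_prop
  have hFsq : ∀ y u, F y u ^ 2 = exp (-(potential σ G u y)) := by
    intro y u
    simp only [F]
    rw [← exp_nat_mul]
    congr 1
    push_cast
    ring
  have hF0 : ∀ y u, 0 < F y u := fun y u => exp_pos _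
  have hFK : ∀ y, ‖y‖ ≤ r → ∀ u, F y u ≤ K := by
    intro y hy u
    simp only [F, hK]
    rw [exp_le_exp]
    have h1 := aux_gns_nonneg σ (G u - y)
    have h2 := aux_gns_le σ y
    have h3 : S * ‖y‖ ^ 2 ≤ S * r ^ 2 := by gcongr
    unfold potential
    linarith
  have hint : ∀ y, ‖y‖ ≤ r → ∀ w, ‖w‖ ≤ r → Integrable (fun u => F y u * F w u) μ₀ := by
    intro y hy w hw
    refine Integrable.of_bound ((hFm y).mul (hFm w)).aestronglyMeasurable (K * K)
      (Eventually.of_forall fun u => ?_)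
    rw [Real.norm_of_nonneg (mul_pos (hF0 y u) (hF0 w u)).le]
    exact mul_le_mul (hFK y hy u) (hFK w hw u) (hF0 w u).le (exp_pos _).le
  have hint2 : ∀ y, ‖y‖ ≤ r → Integrable (fun u => F y u ^ 2) μ₀ := by
    intro y hy
    simpa only [sq] using hint y hy y hy
  have hZ : ∀ y, ∫ u, F y u ^ 2 ∂μ₀ = Zconst σ G μ₀ y := by
    intro y
    simp only [hFsq, Zconst]
  have hZz : ∀ y, ‖y‖ ≤ r → z ≤ Zconst σ G μ₀ y := by
    intro y hy
    rw [← hZ y]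
    refine le_trans ?_ (setIntegral_le_integral (s := X₀) (hint2 y hy)
      (Eventually.of_forall fun u => sq_nonneg _))
    have h1 : z = ∫ u in X₀, exp (-(S * B ^ 2 / 2 + S * (B * r))) ∂μ₀ := by
      rw [setIntegral_const, smul_eq_mul]
    rw [h1]
    refine setIntegral_mono_on (integrable_const _) (hint2 y hy).integrableOn hX₀ fun u hu => ?_
    rw [hFsq, exp_le_exp, aux_pot]
    have h2 := aux_gns_le σ (G u)
    have h3 : S * ‖G u‖ ^ 2 ≤ S * B ^ 2 := by
      have := hGB u hu
      gcongr
    have h4 := (abs_le.1 (aux_pair_le σ (G u) y)).1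
    have h5 : S * (‖G u‖ * ‖y‖) ≤ S * (B * r) := by
      have := hGB u hu
      gcongr
    linarith
  have hdiff : ∀ y, ‖y‖ ≤ r → ∀ w, ‖w‖ ≤ r →
      ∫ u, (F y u - F w u) ^ 2 ∂μ₀ ≤ (K * S / 2) ^ 2 * M * ‖y - w‖ ^ 2 := by
    intro y hy w hw
    have h1 : ∫ u, ((K * S / 2) ^ 2 * ‖y - w‖ ^ 2) * ‖G u‖ ^ 2 ∂μ₀
        = (K * S / 2) ^ 2 * M * ‖y - w‖ ^ 2 := by
      rw [integral_const_mul]; ring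
    rw [← h1]
    refine integral_mono_of_nonneg (Eventually.of_forall fun u => sq_nonneg _)
      (hGsq.const_mul _) (Eventually.of_forall fun u => ?_)
    have h2 : |F y u - F w u| ≤ K * S / 2 * ‖y - w‖ * ‖G u‖ := by
      refine (aux_exp_sub (hFK y hy u) (hFK w hw u)).trans ?_
      have h3 : |-(potential σ G u y) / 2 - -(potential σ G u w) / 2|
          = |potential σ G u y - potential σ G u w| / 2 := by
        rw [show -(potential σ G u y) / 2 - -(potential σ G u w) / 2
          = -((potential σ G u y - potential σ G u w) / 2) by ring, abs_neg, abs_div,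
          abs_of_pos (two_pos : (0 : ℝ) < 2)]
      rw [h3]
      have h4 := mul_le_mul_of_nonneg_left (aux_pot_sub σ G u y w) (exp_pos (S * r ^ 2 / 4)).le
      rw [← hK, ← hS] at h4
      linarith
    have h5 := pow_le_pow_left₀ (abs_nonneg _) h2 2
    rw [sq_abs] at h5
    calc (F y u - F w u) ^ 2 ≤ _ := h5
      _ = _ := by ring
  set D : ℝ := 1 / 2 * ((K * S / 2) ^ 2 * M / z) with hD
  have hD0 : 0 ≤ D := by positivity
  refine ⟨√D + 1, by positivity, fun y₁ y₂ h₁ h₂ => ?_⟩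
  have hZ1 := hZz y₁ h₁
  have hZ2 := hZz y₂ h₂
  have hsq : ∀ y u, √(exp (-(potential σ G u y)) / Zconst σ G μ₀ y)
      = F y u / √(Zconst σ G μ₀ y) := by
    intro y u
    rw [← hFsq, Real.sqrt_div (sq_nonneg _), Real.sqrt_sq (hF0 y u).le]
  simp only [hsq]
  have hH := aux_hilbert μ₀ (F y₁) (F y₂) (√(Zconst σ G μ₀ y₁)) (√(Zconst σ G μ₀ y₂))
    (Real.sqrt_pos.2 (hz0.trans_le hZ1)) (Real.sqrt_pos.2 (hz0.trans_le hZ2))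
    (hint2 y₁ h₁) (hint2 y₂ h₂) (hint y₁ h₁ y₂ h₂)
    (by rw [hZ, Real.sq_sqrt (hz0.le.trans hZ1)]) (by rw [hZ, Real.sq_sqrt (hz0.le.trans hZ2)])
  have hab : z ≤ √(Zconst σ G μ₀ y₁) * √(Zconst σ G μ₀ y₂) := by
    calc z = √z * √z := (Real.mul_self_sqrt hz0.le).symm
      _ ≤ _ := mul_le_mul (Real.sqrt_le_sqrt hZ1) (Real.sqrt_le_sqrt hZ2)
        (Real.sqrt_nonneg _) (Real.sqrt_nonneg _)
  have hfin := hH.trans (div_le_div₀ (by positivity) (hdiff y₁ h₁ y₂ h₂) hz0 hab)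
  calc _ ≤ √(D * ‖y₁ - y₂‖ ^ 2) := by
        apply Real.sqrt_le_sqrt
        calc _ ≤ 1 / 2 * ((K * S / 2) ^ 2 * M * ‖y₁ - y₂‖ ^ 2 / z) :=
              mul_le_mul_of_nonneg_left hfin (by norm_num)
          _ = _ := by rw [hD]; ring
    _ = √D * ‖y₁ - y₂‖ := by rw [Real.sqrt_mul hD0, Real.sqrt_sq (norm_nonneg _)]
    _ ≤ _ := by
        gcongr
        linarith
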